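/- The alternating enrichment 𝒜(ℤ), i.e. the subgroup of Sym(ℤ) generated by the translation t : n ↦ n + 1 and the 3-cycle c = (−1 0 1), is locally stable but not weakly stable. -/

import Mathlib

open Filter Topology

open scoped Classical

/-- Normalized Hamming metric on `Sym(k)`:
`d_k(σ,τ) = |{i : σ i ≠ τ i}| / k` (which equals `1 - |{i : σ i = τ i}|/k` for `k ≥ 1`). -/
noncomputable def dHam {k : ℕ} (σ τ : Equiv.Perm (Fin k)) : ℝ :=
  ((Finset.univ.filter fun i => σ i ≠ τ i).card : ℝ) / k

/-- `(φ_n)` is an almost-homomorphism. -/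
def IsAlmostHom {Γ : Type*} [Group Γ] (k : ℕ → ℕ)
    (φ : ∀ n, Γ → Equiv.Perm (Fin (k n))) : Prop :=
  ∀ g h : Γ,
    Tendsto (fun n => dHam (φ n g * φ n h) (φ n (g * h))) atTop (𝓝 0)

/-- `(φ_n)` is a partial homomorphism. -/
def IsPartialHom {Γ : Type*} [Group Γ] (k : ℕ → ℕ)
    (φ : ∀ n, Γ → Equiv.Perm (Fin (k n))) : Prop :=
  ∀ g h : Γ, ∀ᶠ n in atTop, φ n (g * h) = φ n g * φ n h

/-- `(φ_n)` is separating. -/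
def IsSeparating {Γ : Type*} [Group Γ] (k : ℕ → ℕ)
    (φ : ∀ n, Γ → Equiv.Perm (Fin (k n))) : Prop :=
  ∀ g : Γ, g ≠ 1 → Tendsto (fun n => dHam (φ n g) 1) atTop (𝓝 1)

/-- `(φ_n)` is a sequence of genuine homomorphisms. -/
def IsHomSeq {Γ : Type*} [Group Γ] (k : ℕ → ℕ)
    (φ : ∀ n, Γ → Equiv.Perm (Fin (k n))) : Prop :=
  ∀ n, ∀ g h : Γ, φ n (g * h) = φ n g * φ n h

/-- `(ψ_n)` is asymptotically close to `(φ_n)`: for every `g`, `d_{k_n}(φ_n g, ψ_n g) → 0`. -/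
def CloseSeq {Γ : Type*} [Group Γ] (k : ℕ → ℕ)
    (φ ψ : ∀ n, Γ → Equiv.Perm (Fin (k n))) : Prop :=
  ∀ g : Γ, Tendsto (fun n => dHam (φ n g) (ψ n g)) atTop (𝓝 0)

/-- `Γ` is locally stable. -/
def IsLocallyStable (Γ : Type*) [Group Γ] : Prop :=
  ∀ (k : ℕ → ℕ), (∀ n, 0 < k n) →
    ∀ φ : ∀ n, Γ → Equiv.Perm (Fin (k n)), IsAlmostHom k φ →
      ∃ ψ : ∀ n, Γ → Equiv.Perm (Fin (k n)), IsPartialHom k ψ ∧ CloseSeq k φ ψ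

/-- `Γ` is weakly locally stable. -/
def IsWeaklyLocallyStable (Γ : Type*) [Group Γ] : Prop :=
  ∀ (k : ℕ → ℕ), (∀ n, 0 < k n) →
    ∀ φ : ∀ n, Γ → Equiv.Perm (Fin (k n)), IsAlmostHom k φ → IsSeparating k φ →
      ∃ ψ : ∀ n, Γ → Equiv.Perm (Fin (k n)), IsPartialHom k ψ ∧ CloseSeq k φ ψ

/-- `Γ` is stable (in permutations). -/
def IsStable (Γ : Type*) [Group Γ] : Prop :=
  ∀ (k : ℕ → ℕ), (∀ n, 0 < k n) →
    ∀ φ : ∀ n, Γ → Equiv.Perm (Fin (k n)), IsAlmostHom k φ →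
      ∃ ψ : ∀ n, Γ → Equiv.Perm (Fin (k n)), IsHomSeq k ψ ∧ CloseSeq k φ ψ

/-- `Γ` is weakly stable. -/
def IsWeaklyStable (Γ : Type*) [Group Γ] : Prop :=
  ∀ (k : ℕ → ℕ), (∀ n, 0 < k n) →
    ∀ φ : ∀ n, Γ → Equiv.Perm (Fin (k n)), IsAlmostHom k φ → IsSeparating k φ →
      ∃ ψ : ∀ n, Γ → Equiv.Perm (Fin (k n)), IsHomSeq k ψ ∧ CloseSeq k φ ψ

/-- `Γ` is sofic: it admits a separating almost-homomorphism. -/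
def IsSofic (Γ : Type*) [Group Γ] : Prop :=
  ∃ (k : ℕ → ℕ), (∀ n, 0 < k n) ∧
    ∃ φ : ∀ n, Γ → Equiv.Perm (Fin (k n)), IsAlmostHom k φ ∧ IsSeparating k φ

/-- `Γ` is LEF: it admits a separating partial homomorphism. -/
def IsLEF (Γ : Type*) [Group Γ] : Prop :=
  ∃ (k : ℕ → ℕ), (∀ n, 0 < k n) ∧
    ∃ φ : ∀ n, Γ → Equiv.Perm (Fin (k n)), IsPartialHom k φ ∧ IsSeparating k φ

/-- The translation `n ↦ n + 1` as a permutation of `ℤ`. -/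
def translation : Equiv.Perm ℤ := Equiv.addRight 1

/-- The 3-cycle `(a b c)` (sending `a ↦ b ↦ c ↦ a`) as a permutation of `ℤ`. -/
def threeCycle (a b c : ℤ) : Equiv.Perm ℤ := Equiv.swap a c * Equiv.swap a b

/-- The alternating enrichment `𝒜(ℤ)`: the subgroup of `Sym(ℤ)` generated by the
translation `t : n ↦ n + 1` and the 3-cycle `c = (-1 0 1)` (equivalently, by `FAlt(ℤ)`
together with the image of the regular representation of `ℤ`). -/
def alternatingEnrichment : Subgroup (Equiv.Perm ℤ) :=
  Subgroup.closure {translation, threeCycle (-1) 0 1}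

theorem dHam_nonneg {k : ℕ} (σ τ : Equiv.Perm (Fin k)) : 0 ≤ dHam σ τ := by
  unfold dHam; positivity

theorem dHam_self {k : ℕ} (σ : Equiv.Perm (Fin k)) : dHam σ σ = 0 := by
  simp [dHam]

theorem dHam_comm {k : ℕ} (σ τ : Equiv.Perm (Fin k)) : dHam σ τ = dHam τ σ := by
  simp only [dHam, ne_comm]

theorem dHam_mul_left {k : ℕ} (ρ σ τ : Equiv.Perm (Fin k)) :
    dHam (ρ * σ) (ρ * τ) = dHam σ τ := by
  simp [dHam]

theorem dHam_mul_right {k : ℕ} (σ τ ρ : Equiv.Perm (Fin k)) :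
    dHam (σ * ρ) (τ * ρ) = dHam σ τ := by
  unfold dHam
  congr 2
  refine Finset.card_bij (fun i _ => ρ i)
    (fun i hi => Finset.mem_filter.2 ⟨Finset.mem_univ _, (Finset.mem_filter.1 hi).2⟩) (by simp)
    fun i hi => ⟨ρ.symm i, Finset.mem_filter.2 ⟨Finset.mem_univ _, ?_⟩, by simp⟩
  simpa using (Finset.mem_filter.1 hi).2

theorem dHam_inv {k : ℕ} (σ τ : Equiv.Perm (Fin k)) : dHam σ⁻¹ τ⁻¹ = dHam σ τ := by
  rw [← dHam_mul_left σ, ← dHam_mul_right _ _ τ, dHam_comm]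
  simp

/-- If `σ` and `τ` agree wherever all the pairs `α i`, `β i` agree, their distance is at most
the sum of the distances of these pairs. -/
theorem dHam_le_sum {k : ℕ} {ι : Type*} [Fintype ι] {σ τ : Equiv.Perm (Fin k)}
    {α β : ι → Equiv.Perm (Fin k)} (h : ∀ x, (∀ i, α i x = β i x) → σ x = τ x) :
    dHam σ τ ≤ ∑ i, dHam (α i) (β i) := by
  unfold dHam
  rw [← Finset.sum_div]
  gcongr
  rw [← Nat.cast_sum]
  norm_cast
  refine le_trans (Finset.card_le_card ?_)
    (Finset.card_biUnion_le (s := Finset.univ) (t := fun i : ι =>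
      Finset.univ.filter fun x => α i x ≠ β i x))
  intro x hx
  simp only [Finset.mem_filter, Finset.mem_univ, true_and, Finset.mem_biUnion] at hx ⊢
  by_contra! hc
  exact hx (h x hc)

theorem dHam_triangle {k : ℕ} (σ τ ρ : Equiv.Perm (Fin k)) :
    dHam σ ρ ≤ dHam σ τ + dHam τ ρ := by
  have := dHam_le_sum (σ := σ) (τ := ρ) (α := ![σ, τ]) (β := ![τ, ρ]) fun x hx =>
    (by simpa using hx 0 : σ x = τ x).trans (by simpa using hx 1)
  simpa using this

theorem dHam_mul_mul_le {k : ℕ} (σ σ' τ τ' : Equiv.Perm (Fin k)) :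
    dHam (σ * τ) (σ' * τ') ≤ dHam σ σ' + dHam τ τ' := by
  have := dHam_triangle (σ * τ) (σ' * τ) (σ' * τ')
  rwa [dHam_mul_right, dHam_mul_left] at this

/-- Distances between sequences that are asymptotically zero. -/
theorem tendsto_dHam_trans {k : ℕ → ℕ} {σ τ ρ : ∀ n, Equiv.Perm (Fin (k n))}
    (h₁ : Tendsto (fun n => dHam (σ n) (τ n)) atTop (𝓝 0))
    (h₂ : Tendsto (fun n => dHam (τ n) (ρ n)) atTop (𝓝 0)) :
    Tendsto (fun n => dHam (σ n) (ρ n)) atTop (𝓝 0) :=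
  squeeze_zero (fun _ => dHam_nonneg _ _) (fun _ => dHam_triangle _ _ _)
    (by simpa using h₁.add h₂)

theorem tendsto_dHam_symm {k : ℕ → ℕ} {σ τ : ∀ n, Equiv.Perm (Fin (k n))}
    (h : Tendsto (fun n => dHam (σ n) (τ n)) atTop (𝓝 0)) :
    Tendsto (fun n => dHam (τ n) (σ n)) atTop (𝓝 0) := by
  simpa only [dHam_comm] using h

theorem tendsto_dHam_mul {k : ℕ → ℕ} {σ σ' τ τ' : ∀ n, Equiv.Perm (Fin (k n))}
    (h₁ : Tendsto (fun n => dHam (σ n) (σ' n)) atTop (𝓝 0))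
    (h₂ : Tendsto (fun n => dHam (τ n) (τ' n)) atTop (𝓝 0)) :
    Tendsto (fun n => dHam (σ n * τ n) (σ' n * τ' n)) atTop (𝓝 0) :=
  squeeze_zero (fun _ => dHam_nonneg _ _) (fun _ => dHam_mul_mul_le _ _ _ _)
    (by simpa using h₁.add h₂)

theorem tendsto_dHam_self {k : ℕ → ℕ} (σ : ∀ n, Equiv.Perm (Fin (k n))) :
    Tendsto (fun n => dHam (σ n) (σ n)) atTop (𝓝 0) := by
  simp [dHam_self]

theorem IsPartialHom.isAlmostHom {Γ : Type*} [Group Γ] {k : ℕ → ℕ}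
    {φ : ∀ n, Γ → Equiv.Perm (Fin (k n))} (hφ : IsPartialHom k φ) : IsAlmostHom k φ :=
  fun g h => tendsto_const_nhds.congr' <| by
    filter_upwards [hφ g h] with n hn
    rw [hn, dHam_self]

theorem IsAlmostHom.tendsto_one {Γ : Type*} [Group Γ] {k : ℕ → ℕ}
    {φ : ∀ n, Γ → Equiv.Perm (Fin (k n))} (hφ : IsAlmostHom k φ) :
    Tendsto (fun n => dHam (φ n 1) 1) atTop (𝓝 0) := by
  refine (hφ 1 1).congr fun n => ?_
  rw [mul_one, ← dHam_mul_right _ 1 (φ n 1), one_mul]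

theorem IsAlmostHom.tendsto_inv {Γ : Type*} [Group Γ] {k : ℕ → ℕ}
    {φ : ∀ n, Γ → Equiv.Perm (Fin (k n))} (hφ : IsAlmostHom k φ) (g : Γ) :
    Tendsto (fun n => dHam (φ n g⁻¹) (φ n g)⁻¹) atTop (𝓝 0) := by
  have h := tendsto_dHam_trans (hφ g⁻¹ g) (by simpa using hφ.tendsto_one)
  refine h.congr fun n => ?_
  rw [← dHam_mul_right (φ n g⁻¹) _ (φ n g), inv_mul_cancel]

/-- Two almost-homomorphisms that are close on a generating set are close. -/
theorem IsAlmostHom.closeSeq_of_closure_eq_top {Γ : Type*} [Group Γ] {k : ℕ → ℕ}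
    {φ ψ : ∀ n, Γ → Equiv.Perm (Fin (k n))} (hφ : IsAlmostHom k φ) (hψ : IsAlmostHom k ψ)
    {S : Set Γ} (hS : Subgroup.closure S = ⊤)
    (h : ∀ g ∈ S, Tendsto (fun n => dHam (φ n g) (ψ n g)) atTop (𝓝 0)) : CloseSeq k φ ψ := by
  intro g
  have hg : g ∈ Subgroup.closure S := hS ▸ Subgroup.mem_top g
  induction hg using Subgroup.closure_induction with
  | mem x hx => exact h x hx
  | one => exact tendsto_dHam_trans hφ.tendsto_one (tendsto_dHam_symm hψ.tendsto_one)
  | mul x y _ _ hx hy =>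
    exact tendsto_dHam_trans (tendsto_dHam_symm (hφ x y))
      (tendsto_dHam_trans (tendsto_dHam_mul hx hy) (hψ x y))
  | inv x _ hx =>
    refine tendsto_dHam_trans (hφ.tendsto_inv x)
      (tendsto_dHam_trans ?_ (tendsto_dHam_symm (hψ.tendsto_inv x)))
    simpa only [dHam_inv] using hx

/-- A map from a group to permutations becomes a homomorphism after changing it only at the
points where it fails to be multiplicative. -/
theorem exists_monoidHom_eq_of_mul {A X : Type*} [Group A] (φ : A → Equiv.Perm X) :
    ∃ ρ : A →* Equiv.Perm X,
      ∀ x, (∀ a b, φ a (φ b x) = φ (a * b) x) → ∀ a, ρ a x = φ a x := by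
  let Y : Set X := {x | ∀ a b, φ a (φ b x) = φ (a * b) x}
  have hY : ∀ x ∈ Y, ∀ c, φ c x ∈ Y := fun x hx c a b => by
    rw [hx b c, hx a (b * c), hx (a * b) c, mul_assoc]
  let act : MulAction A X :=
    { smul := fun a x => if x ∈ Y then φ a x else x
      one_smul := fun x => by
        change (if x ∈ Y then φ 1 x else x) = x
        split_ifs with hx
        · exact (φ 1).injective (by simpa using hx 1 1)
        · rfl
      mul_smul := fun a b x => by
        change (if x ∈ Y then φ (a * b) x else x) =
          if (if x ∈ Y then φ b x else x) ∈ Y then φ a (if x ∈ Y then φ b x else x)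
            else (if x ∈ Y then φ b x else x)
        by_cases hx : x ∈ Y
        · simp [hx, hY x hx b, hx a b]
        · simp [hx] }
  exact ⟨MulAction.toPermHom A X, fun x hx a => if_pos hx⟩

theorem isStable_of_finite (A : Type*) [Group A] [Finite A] : IsStable A := by
  intro k _ φ hφ
  have := Fintype.ofFinite A
  choose ρ hρ using fun n => exists_monoidHom_eq_of_mul (φ n)
  refine ⟨fun n a => ρ n a, fun n => map_mul (ρ n), fun a => ?_⟩
  refine squeeze_zero (g := fun n => ∑ p : A × A,
    dHam (φ n p.1 * φ n p.2) (φ n (p.1 * p.2))) (fun _ => dHam_nonneg _ _)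
    (fun n => dHam_le_sum fun x hx => ?_) ?_
  · exact (hρ n x (fun a b => hx (a, b)) a).symm
  · simpa using tendsto_finsetSum Finset.univ fun (p : A × A) _ => hφ p.1 p.2

/-- A permutation of a finite `B`-set becomes equivariant after changing it only at the points
where it fails to be equivariant. -/
theorem exists_commute_eq_of_equivariant {B X : Type*} [Group B] [Finite X]
    (ρ : B →* Equiv.Perm X) (x : Equiv.Perm X) :
    ∃ x' : Equiv.Perm X, (∀ b, x' * ρ b = ρ b * x') ∧
      ∀ y, (∀ b, x (ρ b y) = ρ b (x y)) → x' y = x y := by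
  let Y : Set X := {y | ∀ b, x (ρ b y) = ρ b (x y)}
  have hY : ∀ y ∈ Y, ∀ b, ρ b y ∈ Y := fun y hy b c => by
    rw [hy b, ← Equiv.Perm.mul_apply (ρ c), ← Equiv.Perm.mul_apply (ρ c), ← map_mul, hy]
  have hY' : ∀ y b, ρ b y ∈ Y ↔ y ∈ Y := fun y b =>
    ⟨fun h => by simpa using hY _ h b⁻¹, fun h => hY y h b⟩
  have hw : ∀ v b, x⁻¹ v ∈ Y → x⁻¹ (ρ b v) = ρ b (x⁻¹ v) := fun v b hv => by
    rw [Equiv.Perm.inv_eq_iff_eq, hv b]; simp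
  have hw' : ∀ v b, x⁻¹ (ρ b v) ∈ Y ↔ x⁻¹ v ∈ Y := fun v b => by
    refine ⟨fun h => ?_, fun h => by rw [hw v b h]; exact hY _ h b⟩
    have := hw _ b⁻¹ h
    rw [← Equiv.Perm.mul_apply (ρ b⁻¹), ← map_mul, inv_mul_cancel, map_one,
      Equiv.Perm.one_apply] at this
    rw [this]
    exact hY _ h b⁻¹
  -- Walk backwards along `x` as long as this stays in `Y`.
  let q : X → X := fun v => if x⁻¹ v ∈ Y then x⁻¹ v else v
  have hq : ∀ b, Function.Commute q (ρ b) := fun b v => by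
    simp only [q, hw']
    split_ifs with h
    exacts [hw v b h, rfl]
  have path : ∀ N z, ∃ j, q^[N] z = (x⁻¹ ^ j) z ∧ (∀ l, 1 ≤ l → l ≤ j → (x⁻¹ ^ l) z ∈ Y) ∧
      (j = N ∨ (x⁻¹ ^ (j + 1)) z ∉ Y) := by
    intro N z
    induction N with
    | zero => exact ⟨0, rfl, fun l h₁ h₂ => by omega, Or.inl rfl⟩
    | succ N ih =>
      obtain ⟨j, h₁, h₂, h₃⟩ := ih
      rw [Function.iterate_succ_apply', h₁]
      simp only [q, ← Equiv.Perm.mul_apply, ← pow_succ']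
      split_ifs with h
      · refine ⟨j + 1, rfl, fun l hl hl' => ?_, Or.inl ?_⟩
        · rcases Nat.le_succ_iff.1 hl' with hl' | rfl
          exacts [h₂ l hl hl', h]
        · simpa using h₃.resolve_right (not_not.2 h)
      · exact ⟨j, rfl, h₂, Or.inr h⟩
  set N := orderOf x with hN
  have hNpos : 0 < N := orderOf_pos x
  have hexit : ∀ z ∉ Y, x⁻¹ (q^[N] z) ∉ Y := fun z hz h => by
    obtain ⟨j, h₁, h₂, h₃ | h₃⟩ := path N z
    · refine hz ?_
      have := h₂ j (by omega) le_rfl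
      rwa [h₃, hN, inv_pow, pow_orderOf_eq_one, inv_one] at this
    · rw [h₁, ← Equiv.Perm.mul_apply, ← pow_succ'] at h
      exact h₃ h
  have hinj : ∀ z ∉ Y, ∀ z' ∉ Y, q^[N] z = q^[N] z' → z = z' := by
    intro z hz z' hz' h
    obtain ⟨j, h₁, h₂, -⟩ := path N z
    obtain ⟨j', h₁', h₂', -⟩ := path N z'
    rw [h₁, h₁'] at h
    clear h₁ h₁'
    wlog hjj : j ≤ j' generalizing z z' j j'
    · exact (this z' hz' z hz j' h₂' j h.symm h₂ (by omega)).symm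
    obtain ⟨i, rfl⟩ := Nat.exists_eq_add_of_le hjj
    rw [pow_add, Equiv.Perm.mul_apply] at h
    have h := (x⁻¹ ^ j).injective h
    rcases Nat.eq_zero_or_pos i with rfl | hi
    · simpa using h
    · exact absurd (h ▸ h₂' i hi (by omega)) hz
  let f : X → X := fun z => if z ∈ Y then x z else q^[N] z
  have hf : Function.Injective f := by
    intro z z' h
    by_cases hz : z ∈ Y <;> by_cases hz' : z' ∈ Y <;> simp only [f, hz, hz', if_true, if_false] at h
    · exact x.injective h
    · exact absurd (by rw [← h]; simpa using hz) (hexit z' hz')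
    · exact absurd (by rw [h]; simpa using hz') (hexit z hz)
    · exact hinj z hz z' hz' h
  refine ⟨Equiv.ofBijective f (Finite.injective_iff_bijective.1 hf), fun b => ?_,
    fun y hy => if_pos hy⟩
  ext z
  simp only [Equiv.Perm.mul_apply, Equiv.ofBijective_apply, f, hY']
  split_ifs with h
  exacts [h b, (hq b).iterate_left N z]

theorem exists_tendsto_atTop_of_forall_eventually {P : ℕ → ℕ → Prop}
    (h : ∀ m, ∀ᶠ n in atTop, P m n) :
    ∃ M : ℕ → ℕ, Tendsto M atTop atTop ∧ ∀ᶠ n in atTop, P (M n) n := by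
  refine ⟨fun n => Nat.findGreatest (P · n) n, tendsto_atTop.2 fun m => ?_, ?_⟩
  · filter_upwards [h m, eventually_ge_atTop m] with n hn hmn
    exact Nat.le_findGreatest hmn hn
  · filter_upwards [h 0] with n hn
    exact Nat.findGreatest_spec (P := (P · n)) (Nat.zero_le n) hn

/-- To approximate an almost-homomorphism by a partial homomorphism, it suffices to do so on a
fixed finite generating set by sequences that are multiplicative on a given finite set. -/
theorem IsAlmostHom.exists_isPartialHom_closeSeq {Γ : Type*} [Group Γ] [Countable Γ] {k : ℕ → ℕ}
    {φ : ∀ n, Γ → Equiv.Perm (Fin (k n))} (hφ : IsAlmostHom k φ)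
    {S : Set Γ} (hfin : S.Finite) (hS : Subgroup.closure S = ⊤)
    (h : ∀ F : Finset Γ, ∃ ψ : ∀ n, Γ → Equiv.Perm (Fin (k n)),
      (∀ n, ∀ g ∈ F, ∀ h ∈ F, ψ n (g * h) = ψ n g * ψ n h) ∧
      ∀ g ∈ S, Tendsto (fun n => dHam (φ n g) (ψ n g)) atTop (𝓝 0)) :
    ∃ ψ : ∀ n, Γ → Equiv.Perm (Fin (k n)), IsPartialHom k ψ ∧ CloseSeq k φ ψ := by
  obtain ⟨e, he⟩ := exists_surjective_nat Γ
  choose Ψ hmul hclose using fun m : ℕ => h ((Finset.range m).image e)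
  obtain ⟨M, hM, hMP⟩ := exists_tendsto_atTop_of_forall_eventually
    (P := fun m n => ∀ g ∈ S, dHam (φ n g) (Ψ m n g) < 1 / ((m : ℝ) + 1)) fun m =>
      (eventually_all_finite hfin).2 fun g hg =>
        (hclose m g hg).eventually_lt_const (by positivity)
  have hpart : IsPartialHom k fun n => Ψ (M n) n := by
    intro g h
    obtain ⟨i, rfl⟩ := he g
    obtain ⟨j, rfl⟩ := he h
    filter_upwards [hM.eventually_gt_atTop i, hM.eventually_gt_atTop j] with n hi hj
    exact hmul _ _ _ (Finset.mem_image_of_mem e (Finset.mem_range.2 hi)) _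
      (Finset.mem_image_of_mem e (Finset.mem_range.2 hj))
  refine ⟨_, hpart, hφ.closeSeq_of_closure_eq_top hpart.isAlmostHom hS fun g hg => ?_⟩
  refine squeeze_zero' (Eventually.of_forall fun _ => dHam_nonneg _ _) ?_
    (tendsto_one_div_add_atTop_nhds_zero_nat.comp hM)
  filter_upwards [hMP] with n hn using (hn g hg).le

namespace alternatingEnrichment

/-- The translation as an element of `𝒜(ℤ)`. -/
def shift : alternatingEnrichment :=
  ⟨translation, Subgroup.subset_closure (by simp)⟩

/-- The 3-cycle `(-1 0 1)` as an element of `𝒜(ℤ)`. -/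
def cycle : alternatingEnrichment :=
  ⟨threeCycle (-1) 0 1, Subgroup.subset_closure (by simp)⟩

theorem closure_shift_cycle :
    Subgroup.closure {shift, cycle} = (⊤ : Subgroup alternatingEnrichment) := by
  refine Eq.trans (congrArg _ ?_)
    (Subgroup.closure_closure_coe_preimage (k := {translation, threeCycle (-1) 0 1}))
  ext g
  simp only [shift, cycle, Set.mem_insert_iff, Set.mem_singleton_iff, Subtype.ext_iff]
  rfl

instance : Countable alternatingEnrichment := by
  obtain ⟨S, hS, f, hf⟩ := Group.fg_iff_exists_freeGroup_hom_surjective.1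
    ((Group.fg_iff).2 ⟨_, closure_shift_cycle, Set.toFinite _⟩)
  have := hS.to_subtype
  exact hf.countable

theorem shift_smul (x : ℤ) : shift • x = x + 1 := rfl

theorem shift_inv_smul (x : ℤ) : shift⁻¹ • x = x - 1 := by
  rw [inv_smul_eq_iff, shift_smul]; ring

theorem shift_zpow_smul (j x : ℤ) : shift ^ j • x = x + j := by
  induction j generalizing x with
  | zero => simp
  | succ j ih => rw [zpow_add_one, mul_smul, ih, shift_smul]; ring
  | pred j ih => rw [zpow_sub_one, mul_smul, ih, shift_inv_smul]; ring

theorem cycle_smul (x : ℤ) :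
    cycle • x = if x = -1 then 0 else if x = 0 then 1 else if x = 1 then -1 else x := by
  change threeCycle (-1) 0 1 x = _
  simp only [threeCycle, Equiv.Perm.mul_apply, Equiv.swap_apply_def]
  split_ifs <;> simp_all

theorem ext_smul {g h : alternatingEnrichment} (H : ∀ x : ℤ, g • x = h • x) : g = h :=
  Subtype.ext (Equiv.ext H)

/-- The elements of `𝒜(ℤ)` supported in the interval `[p, q]`. -/
def window (p q : ℤ) : Subgroup alternatingEnrichment :=
  fixingSubgroup alternatingEnrichment (Set.Icc p q)ᶜ

theorem mem_window {p q : ℤ} {g : alternatingEnrichment} :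
    g ∈ window p q ↔ ∀ x : ℤ, x < p ∨ q < x → g • x = x := by
  simp only [window, mem_fixingSubgroup_iff, Set.mem_compl_iff, Set.mem_Icc, not_and_or, not_le]

theorem window_mono {p q p' q' : ℤ} (hp : p' ≤ p) (hq : q ≤ q') : window p q ≤ window p' q' :=
  fun _ hg => mem_window.2 fun x hx => mem_window.1 hg x (by omega)

theorem smul_mem_Icc_of_mem_window {p q : ℤ} {g : alternatingEnrichment} (hg : g ∈ window p q)
    {x : ℤ} (hx : x ∈ Set.Icc p q) : g • x ∈ Set.Icc p q := by
  by_contra hc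
  have h := (mem_fixingSubgroup_iff _).1 hg _ hc
  rw [smul_left_cancel_iff] at h
  exact hc (h.symm ▸ hx)

instance (p q : ℤ) : Finite (window p q) := by
  refine Finite.of_injective
    (fun g (x : Set.Icc p q) => (⟨g.1 • x.1, smul_mem_Icc_of_mem_window g.2 x.2⟩ : Set.Icc p q))
    fun g h H => Subtype.ext (ext_smul fun x => ?_)
  by_cases hx : x ∈ Set.Icc p q
  · exact congrArg Subtype.val (congrFun H ⟨x, hx⟩)
  · exact ((mem_fixingSubgroup_iff _).1 g.2 x hx).trans ((mem_fixingSubgroup_iff _).1 h.2 x hx).symm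

theorem shift_zpow_conj_mem_window {p q : ℤ} {g : alternatingEnrichment} (hg : g ∈ window p q)
    (j : ℤ) : shift ^ j * g * (shift ^ j)⁻¹ ∈ window (p + j) (q + j) := by
  refine mem_window.2 fun x hx => ?_
  rw [mul_smul, mul_smul, ← zpow_neg, shift_zpow_smul, shift_zpow_smul,
    mem_window.1 hg _ (by omega)]
  ring

theorem commute_of_mem_window {p q p' q' : ℤ} {g h : alternatingEnrichment}
    (hg : g ∈ window p q) (hh : h ∈ window p' q') (hpq : q < p') : Commute g h := by
  have key : Equiv.Perm.Disjoint (g : Equiv.Perm ℤ) (h : Equiv.Perm ℤ) := fun x => by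
    by_cases hx : q < x
    · exact Or.inl (mem_window.1 hg x (Or.inr hx))
    · exact Or.inr (mem_window.1 hh x (Or.inl (by omega)))
  exact Subtype.ext key.commute

theorem cycle_mem_window : cycle ∈ window (-1) 1 :=
  mem_window.2 fun x hx => by rw [cycle_smul]; split_ifs <;> omega

/-! ### Decomposition into a finitely supported part and a translation -/

theorem exists_zpow_mem_window (g : alternatingEnrichment) :
    ∃ (j : ℤ) (K : ℕ), g * (shift ^ j)⁻¹ ∈ window (-K) K := by
  have hg : g ∈ Subgroup.closure {shift, cycle} := closure_shift_cycle ▸ Subgroup.mem_top g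
  induction hg using Subgroup.closure_induction with
  | mem x hx =>
    rcases hx with rfl | rfl
    · exact ⟨1, 0, by simp⟩
    · exact ⟨0, 1, by simpa using cycle_mem_window⟩
  | one => exact ⟨0, 0, by simp⟩
  | mul x y _ _ hx hy =>
    obtain ⟨i, K, hK⟩ := hx
    obtain ⟨j, L, hL⟩ := hy
    refine ⟨i + j, K + L + i.natAbs, ?_⟩
    have h := mul_mem (window_mono (p' := -(K + L + i.natAbs : ℕ)) (q' := (K + L + i.natAbs : ℕ))
      (by omega) (by omega) hK) (window_mono (by omega) (by omega) (shift_zpow_conj_mem_window hL i))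
    convert h using 1
    rw [zpow_add]
    group
  | inv x _ hx =>
    obtain ⟨i, K, hK⟩ := hx
    refine ⟨-i, K + i.natAbs, ?_⟩
    refine window_mono (by omega) (by omega)
      (?_ : _ ∈ window (-K + -i) (K + -i))
    convert shift_zpow_conj_mem_window (inv_mem hK) (-i) using 1
    group

/-- The translation amount of an element of `𝒜(ℤ)` near infinity. -/
noncomputable def drift (g : alternatingEnrichment) : ℤ := (exists_zpow_mem_window g).choose

/-- The finitely supported part of an element of `𝒜(ℤ)`. -/
noncomputable def resid (g : alternatingEnrichment) : alternatingEnrichment :=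
  g * (shift ^ drift g)⁻¹

theorem exists_resid_mem_window (g : alternatingEnrichment) :
    ∃ K : ℕ, resid g ∈ window (-K) K :=
  (exists_zpow_mem_window g).choose_spec

theorem resid_mul_zpow (g : alternatingEnrichment) : resid g * shift ^ drift g = g := by
  simp [resid]

theorem drift_mul_zpow {p q : ℤ} {a : alternatingEnrichment} (ha : a ∈ window p q) (j : ℤ) :
    drift (a * shift ^ j) = j := by
  obtain ⟨K, hK⟩ := exists_resid_mem_window (a * shift ^ j)
  set d := drift (a * shift ^ j) with hd
  have h := mem_window.1 hK (max (K + 1) (q + d - j + 1)) (by omega)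
  rw [resid, ← hd, mul_smul, mul_smul, ← zpow_neg, shift_zpow_smul, shift_zpow_smul,
    mem_window.1 ha _ (by omega)] at h
  omega

theorem resid_mul_zpow_eq {p q : ℤ} {a : alternatingEnrichment} (ha : a ∈ window p q) (j : ℤ) :
    resid (a * shift ^ j) = a := by
  simp [resid, drift_mul_zpow ha]

theorem mul_eq_resid (g h : alternatingEnrichment) :
    g * h = resid g * (shift ^ drift g * resid h * (shift ^ drift g)⁻¹) *
      shift ^ (drift g + drift h) := by
  conv_lhs => rw [← resid_mul_zpow g, ← resid_mul_zpow h]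
  rw [zpow_add]
  group

/-! ### Homomorphisms defined on a window -/

section extend

variable {G : Type*} [Group G] {m : ℕ}

/-- The map on `𝒜(ℤ)` induced by a map on finitely supported elements and the image of the
translation. -/
noncomputable def extend (r : alternatingEnrichment → G) (τ : G) (g : alternatingEnrichment) : G :=
  r (resid g) * τ ^ drift g

theorem pow_mul_eq_conj_mul_pow {r : alternatingEnrichment → G} {τ : G}
    (hτ : ∀ b ∈ window (-m) (m - 1), τ * r b = r (shift * b * shift⁻¹) * τ)
    (j : ℕ) {p q : ℤ} (hp : -m ≤ p) (hq : q + j ≤ m) {a : alternatingEnrichment}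
    (ha : a ∈ window p q) :
    τ ^ j * r a = r (shift ^ (j : ℤ) * a * (shift ^ (j : ℤ))⁻¹) * τ ^ j := by
  induction j with
  | zero => simp
  | succ j ih =>
    rw [pow_succ', mul_assoc, ih (by push_cast at hq; omega), ← mul_assoc,
      hτ _ (window_mono (by omega) (by push_cast at hq; omega) (shift_zpow_conj_mem_window ha j)),
      mul_assoc]
    congr 2
    push_cast
    group

theorem zpow_mul_eq_conj_mul_zpow {r : alternatingEnrichment → G} {τ : G}
    (hτ : ∀ b ∈ window (-m) (m - 1), τ * r b = r (shift * b * shift⁻¹) * τ)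
    {j : ℤ} {K : ℕ} (hK : K + j.natAbs ≤ m) {a : alternatingEnrichment}
    (ha : a ∈ window (-K) K) :
    τ ^ j * r a = r (shift ^ j * a * (shift ^ j)⁻¹) * τ ^ j := by
  obtain ⟨i, rfl | rfl⟩ := j.eq_nat_or_neg
  · exact_mod_cast pow_mul_eq_conj_mul_pow hτ i (by omega) (by omega) ha
  · have h := pow_mul_eq_conj_mul_pow hτ i (by omega) (by omega)
      (shift_zpow_conj_mem_window ha (-i))
    have h' : shift ^ (i : ℤ) * (shift ^ (-i : ℤ) * a * (shift ^ (-i : ℤ))⁻¹) *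
        (shift ^ (i : ℤ))⁻¹ = a := by group
    rw [h'] at h
    rw [zpow_neg τ, zpow_natCast, inv_mul_eq_iff_eq_mul, ← mul_assoc, h, mul_inv_cancel_right]

theorem extend_mul {r : alternatingEnrichment → G} {τ : G}
    (hr : ∀ a ∈ window (-m) m, ∀ b ∈ window (-m) m, r (a * b) = r a * r b)
    (hτ : ∀ b ∈ window (-m) (m - 1), τ * r b = r (shift * b * shift⁻¹) * τ)
    {g h : alternatingEnrichment} {K : ℕ} (hK : 2 * K ≤ m) (hg : resid g ∈ window (-K) K)
    (hh : resid h ∈ window (-K) K) (hd : (drift g).natAbs ≤ K) :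
    extend r τ (g * h) = extend r τ g * extend r τ h := by
  have hg' := window_mono (p' := -m) (q' := m) (by omega) (by omega) hg
  have hh' := window_mono (p' := -m) (q' := m) (by omega) (by omega)
    (shift_zpow_conj_mem_window hh (drift g))
  have hgh := mul_mem hg' hh'
  rw [extend, mul_eq_resid g h, drift_mul_zpow hgh, resid_mul_zpow_eq hgh, hr _ hg' _ hh',
    extend, extend, zpow_add, mul_assoc (r (resid g)), ← mul_assoc _ (τ ^ drift g),
    ← zpow_mul_eq_conj_mul_zpow hτ (by omega) hh]
  simp only [mul_assoc]

theorem extend_shift {r : alternatingEnrichment → G} (hr : r 1 = 1) (τ : G) :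
    extend r τ shift = τ := by
  have h := one_mem (window 0 0)
  have h1 := drift_mul_zpow h 1
  have h2 := resid_mul_zpow_eq h 1
  simp only [one_mul, zpow_one] at h1 h2
  simp [extend, h1, h2, hr]

theorem extend_of_mem_window (r : alternatingEnrichment → G) (τ : G) {p q : ℤ}
    {a : alternatingEnrichment} (ha : a ∈ window p q) : extend r τ a = r a := by
  have h1 := drift_mul_zpow ha 0
  have h2 := resid_mul_zpow_eq ha 0
  simp only [mul_one, zpow_zero] at h1 h2
  simp [extend, h1, h2]

/-- Extension by `1` of a homomorphism defined on a window. -/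
noncomputable def extendOne {p q : ℤ} (ρ : window p q →* G) (g : alternatingEnrichment) : G :=
  if h : g ∈ window p q then ρ ⟨g, h⟩ else 1

theorem extendOne_of_mem {p q : ℤ} (ρ : window p q →* G) {g : alternatingEnrichment}
    (h : g ∈ window p q) : extendOne ρ g = ρ ⟨g, h⟩ := dif_pos h

theorem extendOne_mul {p q : ℤ} (ρ : window p q →* G) {a b : alternatingEnrichment}
    (ha : a ∈ window p q) (hb : b ∈ window p q) :
    extendOne ρ (a * b) = extendOne ρ a * extendOne ρ b := by
  rw [extendOne_of_mem ρ ha, extendOne_of_mem ρ hb, extendOne_of_mem ρ (mul_mem ha hb), ← map_mul]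
  rfl

theorem extendOne_one {p q : ℤ} (ρ : window p q →* G) : extendOne ρ 1 = 1 := by
  rw [extendOne_of_mem ρ (one_mem _)]; exact map_one ρ

end extend

/-! ### Rotating a window -/

theorem exists_rotation (p : ℤ) (m : ℕ) : ∃ s : alternatingEnrichment, ∀ x : ℤ,
    s • x = if p ≤ x ∧ x < p + 2 * m then x + 1 else if x = p + 2 * m then p else x := by
  induction m with
  | zero => exact ⟨1, fun x => by rw [one_smul]; split_ifs <;> push_cast at * <;> omega⟩
  | succ m ih =>
    obtain ⟨s, hs⟩ := ih
    refine ⟨s * (shift ^ (p + 2 * m + 1) * cycle * (shift ^ (p + 2 * m + 1))⁻¹), fun x => ?_⟩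
    rw [mul_smul, mul_smul, mul_smul, ← zpow_neg, shift_zpow_smul, shift_zpow_smul, cycle_smul, hs]
    push_cast
    split_ifs <;> omega

/-- The cyclic permutation `x ↦ x + 1` of the interval `[-m, m]`. -/
noncomputable def rotation (m : ℕ) : alternatingEnrichment := (exists_rotation (-m) m).choose

theorem rotation_smul (m : ℕ) (x : ℤ) :
    rotation m • x = if -m ≤ x ∧ x < m then x + 1 else if x = m then (-m : ℤ) else x := by
  rw [rotation, (exists_rotation (-m) m).choose_spec x]
  split_ifs <;> omega

theorem rotation_mem_window (m : ℕ) : rotation m ∈ window (-m) m :=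
  mem_window.2 fun x hx => by rw [rotation_smul]; split_ifs <;> omega

theorem rotation_mul {m : ℕ} {b : alternatingEnrichment} (hb : b ∈ window (-m) (m - 1)) :
    rotation m * b = shift * b * shift⁻¹ * rotation m := by
  refine ext_smul fun x => ?_
  simp only [mul_smul, shift_smul, shift_inv_smul]
  by_cases hx : x ∈ Set.Icc (-m : ℤ) (m - 1)
  · obtain ⟨h₁, h₂⟩ := smul_mem_Icc_of_mem_window hb hx
    obtain ⟨h₃, h₄⟩ := hx
    rw [rotation_smul, rotation_smul, if_pos ⟨h₁, by omega⟩, if_pos ⟨h₃, by omega⟩,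
      add_sub_cancel_right]
  · rw [Set.mem_Icc, not_and_or, not_le, not_le] at hx
    rw [mem_window.1 hb x hx, mem_window.1 hb, sub_add_cancel]
    rw [rotation_smul]
    split_ifs <;> omega

theorem rotation_pow_smul {m : ℕ} (j : ℕ) {x : ℤ} (hx : -m ≤ x) (hj : x + j ≤ m) :
    rotation m ^ j • x = x + j := by
  induction j with
  | zero => simp
  | succ j ih =>
    push_cast at hj
    rw [pow_succ', mul_smul, ih (by omega), rotation_smul, if_pos (by omega)]
    push_cast
    ring

end alternatingEnrichment
namespace alternatingEnrichment

/-! ### Local stability -/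

theorem extend_extendOne_mul {G : Type*} [Group G] {m : ℕ} (ρ : window (-m) m →* G) {τ : G}
    (hτ : ∀ b (hb : b ∈ window (-m) (m - 1)),
      τ * ρ ⟨b, window_mono le_rfl (by omega) hb⟩ = ρ ⟨rotation m * b * (rotation m)⁻¹,
        mul_mem (mul_mem (rotation_mem_window m) (window_mono le_rfl (by omega) hb))
          (inv_mem (rotation_mem_window m))⟩ * τ)
    {g h : alternatingEnrichment} {K : ℕ} (hK : 2 * K ≤ m) (hg : resid g ∈ window (-K) K)
    (hh : resid h ∈ window (-K) K) (hd : (drift g).natAbs ≤ K) :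
    extend (extendOne ρ) τ (g * h) = extend (extendOne ρ) τ g * extend (extendOne ρ) τ h := by
  refine extend_mul (fun a ha b hb => extendOne_mul ρ ha hb) (fun b hb => ?_) hK hg hh hd
  have h := hτ b hb
  simp only [rotation_mul hb, mul_inv_cancel_right] at h
  rw [extendOne_of_mem ρ (window_mono le_rfl (by omega) hb), h, extendOne_of_mem]

theorem exists_bound (F : Finset alternatingEnrichment) :
    ∃ K : ℕ, ∀ g ∈ F, resid g ∈ window (-K) K ∧ (drift g).natAbs ≤ K := by
  choose L hL using exists_resid_mem_window
  refine ⟨F.sup fun g => L g + (drift g).natAbs, fun g hg => ?_⟩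
  have h := Finset.le_sup (f := fun g => L g + (drift g).natAbs) hg
  exact ⟨window_mono (by omega) (by omega) (hL g), by omega⟩

theorem exists_approximation {k : ℕ → ℕ} (hk : ∀ n, 0 < k n)
    {φ : ∀ n, alternatingEnrichment → Equiv.Perm (Fin (k n))} (hφ : IsAlmostHom k φ) (m : ℕ) :
    ∃ (ρ : ∀ n, window (-m) m →* Equiv.Perm (Fin (k n))) (τ : ∀ n, Equiv.Perm (Fin (k n))),
      (∀ n b (hb : b ∈ window (-m) (m - 1)),
        τ n * ρ n ⟨b, window_mono le_rfl (by omega) hb⟩ =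
          ρ n ⟨rotation m * b * (rotation m)⁻¹,
            mul_mem (mul_mem (rotation_mem_window m) (window_mono le_rfl (by omega) hb))
              (inv_mem (rotation_mem_window m))⟩ * τ n) ∧
      (∀ a : window (-m) m, Tendsto (fun n => dHam (φ n a) (ρ n a)) atTop (𝓝 0)) ∧
      Tendsto (fun n => dHam (φ n shift) (τ n)) atTop (𝓝 0) := by
  obtain ⟨ψ, hψ, hclose⟩ := isStable_of_finite (window (-m) m) k hk (fun n a => φ n a)
    fun a b => hφ a b
  let ρ n : window (-m) m →* Equiv.Perm (Fin (k n)) := MonoidHom.mk' (ψ n) (hψ n)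
  let s : window (-m) m := ⟨rotation m, rotation_mem_window m⟩
  let ι : window (-m) (m - 1) →* window (-m) m :=
    Subgroup.inclusion (window_mono le_rfl (by omega))
  have := Fintype.ofFinite (window (-m) (m - 1 : ℤ))
  choose x hx hx' using fun n =>
    exists_commute_eq_of_equivariant ((ρ n).comp ι) ((ρ n s)⁻¹ * φ n shift)
  refine ⟨ρ, fun n => ρ n s * x n, fun n b hb => ?_, hclose, ?_⟩
  · have h : (⟨rotation m * b * (rotation m)⁻¹, mul_mem (mul_mem (rotation_mem_window m)
        (window_mono le_rfl (by omega) hb)) (inv_mem (rotation_mem_window m))⟩ : window (-m) m) =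
        s * ι ⟨b, hb⟩ * s⁻¹ := rfl
    rw [h, map_mul, map_mul, map_inv, mul_assoc, mul_assoc, mul_assoc, inv_mul_cancel_left]
    exact congrArg (ρ n s * ·) (hx n ⟨b, hb⟩)
  · have hsum : Tendsto (fun n => ∑ b : window (-m) (m - 1 : ℤ),
        dHam ((ρ n s)⁻¹ * φ n shift * ρ n (ι b)) (ρ n (ι b) * ((ρ n s)⁻¹ * φ n shift)))
        atTop (𝓝 0) := by
      rw [← Finset.sum_const_zero (s := (Finset.univ : Finset (window (-m) (m - 1 : ℤ))))]
      refine tendsto_finsetSum _ fun b _ => ?_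
      have h₁ := tendsto_dHam_mul (tendsto_dHam_self fun n => φ n shift)
        (tendsto_dHam_symm (hclose (ι b)))
      have h₂ := hφ shift b
      have h₃ := tendsto_dHam_symm (hφ (shift * b * shift⁻¹) shift)
      have h₄ := tendsto_dHam_mul (hclose (s * ι b * s⁻¹)) (tendsto_dHam_self fun n => φ n shift)
      have hs : ((s * ι b * s⁻¹ : window (-m) m) : alternatingEnrichment) =
          shift * b * shift⁻¹ := by
        rw [← mul_inv_eq_of_eq_mul (rotation_mul b.2)]; rfl
      simp only [hs] at h₄
      simp only [inv_mul_cancel_right] at h₃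
      refine (tendsto_dHam_trans h₁ (tendsto_dHam_trans h₂ (tendsto_dHam_trans h₃ h₄))).congr
        fun n => ?_
      rw [← dHam_mul_left (ρ n s) ((ρ n s)⁻¹ * φ n shift * ρ n (ι b))]
      congr 1
      · rw [mul_assoc, mul_inv_cancel_left]; rfl
      · change ρ n (s * ι b * s⁻¹) * _ = _
        simp only [map_mul, map_inv, mul_assoc]
    refine squeeze_zero (fun _ => dHam_nonneg _ _) (fun n => ?_) hsum
    rw [← dHam_mul_left (ρ n s)⁻¹, inv_mul_cancel_left, dHam_comm]
    exact dHam_le_sum fun y hy => hx' n y hy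

theorem isLocallyStable : IsLocallyStable alternatingEnrichment := by
  intro k hk φ hφ
  refine hφ.exists_isPartialHom_closeSeq (Set.toFinite _) closure_shift_cycle fun F => ?_
  obtain ⟨K, hK⟩ := exists_bound F
  obtain ⟨ρ, τ, hτ, hρ, hτ'⟩ := exists_approximation hk hφ (2 * K + 1)
  refine ⟨fun n => extend (extendOne (ρ n)) (τ n), fun n g hg h hh =>
    extend_extendOne_mul (ρ n) (hτ n) (by omega) (hK g hg).1 (hK h hh).1 (hK g hg).2, ?_⟩
  rintro g (rfl | rfl)
  · simpa only [extend_shift (extendOne_one _)] using hτ'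
  · have hc := window_mono (p' := -(2 * K + 1 : ℕ)) (q' := (2 * K + 1 : ℕ)) (by omega) (by omega)
      cycle_mem_window
    simpa only [extend_of_mem_window _ _ hc, extendOne_of_mem _ hc] using hρ ⟨cycle, hc⟩

/-! ### Failure of weak stability -/

theorem cycle_pow_three : cycle ^ 3 = 1 := by
  refine ext_smul fun x => ?_
  rw [pow_succ, pow_two, mul_smul, mul_smul, one_smul]
  by_cases h₁ : x = -1
  · simp [h₁, cycle_smul]
  by_cases h₂ : x = 0
  · simp [h₂, cycle_smul]
  by_cases h₃ : x = 1
  · simp [h₃, cycle_smul]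
  simp [h₁, h₂, h₃, cycle_smul]

theorem cycle_mul_conj_pow_two :
    (cycle * (shift ^ (1 : ℤ) * cycle * (shift ^ (1 : ℤ))⁻¹)) ^ 2 = 1 := by
  set g := cycle * (shift ^ (1 : ℤ) * cycle * (shift ^ (1 : ℤ))⁻¹) with hg
  have h : ∀ y : ℤ, g • y = if y = -1 then 0 else if y = 0 then -1 else if y = 1 then 2
      else if y = 2 then 1 else y := fun y => by
    simp only [hg, mul_smul, ← zpow_neg, shift_zpow_smul, cycle_smul]
    split_ifs <;> omega
  refine ext_smul fun x => ?_
  rw [pow_two, mul_smul, one_smul]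
  by_cases h₁ : x = -1
  · simp [h₁, h]
  by_cases h₂ : x = 0
  · simp [h₂, h]
  by_cases h₃ : x = 1
  · simp [h₃, h]
  by_cases h₄ : x = 2
  · simp [h₄, h]
  simp [h₁, h₂, h₃, h₄, h]

theorem cycle_mul_conj_pow_five :
    (cycle * (shift ^ (2 : ℤ) * cycle * (shift ^ (2 : ℤ))⁻¹)) ^ 5 = 1 := by
  set g := cycle * (shift ^ (2 : ℤ) * cycle * (shift ^ (2 : ℤ))⁻¹) with hg
  have h : ∀ y : ℤ, g • y = if y = -1 then 0 else if y = 0 then 1 else if y = 1 then 2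
      else if y = 2 then 3 else if y = 3 then -1 else y := fun y => by
    simp only [hg, mul_smul, ← zpow_neg, shift_zpow_smul, cycle_smul]
    split_ifs <;> omega
  refine ext_smul fun x => ?_
  rw [pow_succ, pow_succ, pow_succ, pow_two, mul_smul, mul_smul, mul_smul, mul_smul, one_smul]
  by_cases h₁ : x = -1
  · simp [h₁, h]
  by_cases h₂ : x = 0
  · simp [h₂, h]
  by_cases h₃ : x = 1
  · simp [h₃, h]
  by_cases h₄ : x = 2
  · simp [h₄, h]
  by_cases h₅ : x = 3
  · simp [h₅, h]
  simp [h₁, h₂, h₃, h₄, h₅, h]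

/-- Every homomorphism from `𝒜(ℤ)` to a finite group kills the 3-cycle. -/
theorem map_cycle_eq_one {H : Type*} [Group H] [Finite H] (f : alternatingEnrichment →* H) :
    f cycle = 1 := by
  have hcomm : ∀ j : ℤ, Commute (f cycle) (f (shift ^ j * cycle * (shift ^ j)⁻¹)) := by
    intro j
    set N : ℕ := Nat.card H * (j.natAbs + 3) with hN
    have hN' : j.natAbs + 3 ≤ N := Nat.le_mul_of_pos_left _ Nat.card_pos
    have h := (commute_of_mem_window (shift_zpow_conj_mem_window cycle_mem_window j)
      (shift_zpow_conj_mem_window cycle_mem_window N) (by omega)).map f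
    have hf : f (shift ^ (N : ℤ)) = 1 := by
      rw [zpow_natCast, map_pow, hN, pow_mul, pow_card_eq_one', one_pow]
    rw [map_mul f (shift ^ (N : ℤ) * cycle), map_mul f (shift ^ (N : ℤ)) cycle, map_inv, hf,
      one_mul, inv_one, mul_one] at h
    exact h.symm
  have h3 : f cycle ^ 3 = 1 := by rw [← map_pow, cycle_pow_three, map_one]
  have h3' : ∀ j : ℤ, f (shift ^ j * cycle * (shift ^ j)⁻¹) ^ 3 = 1 := fun j => by
    rw [← map_pow, conj_pow, cycle_pow_three, mul_one, mul_inv_cancel, map_one]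
  -- Adjacent conjugates map to mutually inverse elements, so `f cycle` commutes with
  -- `f shift ^ 2`.
  have hinv : f cycle * f (shift ^ (1 : ℤ) * cycle * (shift ^ (1 : ℤ))⁻¹) = 1 := by
    have h2 := congrArg f cycle_mul_conj_pow_two
    rw [map_pow, map_mul, map_one] at h2
    have h3 : (f cycle * f (shift ^ (1 : ℤ) * cycle * (shift ^ (1 : ℤ))⁻¹)) ^ 3 = 1 := by
      rw [(hcomm 1).mul_pow, h3, h3', one_mul]
    rwa [pow_succ, h2, one_mul] at h3
  have hconj : f shift * f cycle * (f shift)⁻¹ = (f cycle)⁻¹ := by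
    rw [inv_eq_of_mul_eq_one_right hinv, zpow_one, map_mul, map_mul, map_inv]
  have hsq : f (shift ^ (2 : ℤ) * cycle * (shift ^ (2 : ℤ))⁻¹) = f cycle := by
    calc f (shift ^ (2 : ℤ) * cycle * (shift ^ (2 : ℤ))⁻¹)
        = f shift * (f shift * f cycle * (f shift)⁻¹) * (f shift)⁻¹ := by
          simp only [zpow_two, map_mul, map_inv, mul_inv_rev, mul_assoc]
      _ = (f shift * f cycle * (f shift)⁻¹)⁻¹ := by rw [conj_inv, hconj]
      _ = f cycle := by rw [hconj, inv_inv]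
  have h5 := congrArg f cycle_mul_conj_pow_five
  rw [map_pow, map_mul, hsq, map_one, ← pow_two, ← pow_mul] at h5
  calc f cycle = f cycle ^ (2 * 5) * ((f cycle ^ 3) ^ 3)⁻¹ := by group
    _ = 1 := by rw [h5, h3]; simp

/-- The approximations of `𝒜(ℤ)` by the finite groups `window (-m) m`. -/
noncomputable def toWindow (m : ℕ) (g : alternatingEnrichment) : window (-m) m :=
  extend (extendOne (MonoidHom.id _)) ⟨rotation m, rotation_mem_window m⟩ g

theorem eventually_toWindow_mul (g h : alternatingEnrichment) :
    ∀ᶠ m in atTop, toWindow m (g * h) = toWindow m g * toWindow m h := by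
  obtain ⟨K, hK⟩ := exists_bound {g, h}
  filter_upwards [eventually_ge_atTop (2 * K)] with m hm
  refine extend_extendOne_mul _ (fun b hb => Subtype.ext ?_) hm (hK g (by simp)).1
    (hK h (by simp)).1 (hK g (by simp)).2
  simp

theorem eventually_toWindow_ne_one {g : alternatingEnrichment} (hg : g ≠ 1) :
    ∀ᶠ m in atTop, toWindow m g ≠ 1 := by
  obtain ⟨K, hK⟩ := exists_bound {g}
  obtain ⟨hr, hd⟩ := hK g (by simp)
  filter_upwards [eventually_ge_atTop (2 * K + 1)] with m hm h1
  have hr' := window_mono (p' := -m) (q' := m) (by omega) (by omega) hr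
  have key : resid g * rotation m ^ drift g = 1 := by
    have := congrArg Subtype.val h1
    simpa only [toWindow, extend, extendOne_of_mem _ hr', Subgroup.coe_mul, Subgroup.coe_zpow,
      MonoidHom.id_apply, Subgroup.coe_one] using this
  have hmem : rotation m ^ (drift g).natAbs ∈ window (-K) K := by
    rcases Int.natAbs_eq (drift g) with h | h
    · rw [← zpow_natCast, ← h, ← inv_eq_of_mul_eq_one_right key]
      exact inv_mem hr
    · rw [← zpow_natCast, ← neg_eq_iff_eq_neg.2 h, zpow_neg, inv_eq_of_mul_eq_one_left key]
      exact hr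
  have h := mem_window.1 hmem (K + 1) (by omega)
  rw [rotation_pow_smul _ (by omega) (by omega)] at h
  have h0 : drift g = 0 := by omega
  rw [h0, zpow_zero, mul_one] at key
  exact hg (by rw [← resid_mul_zpow g, key, h0, zpow_zero, mul_one])

/-- The regular representation of `window (-m) m`, on points numbered by `Fin`. -/
noncomputable def regularRep (m : ℕ) :
    window (-m) m →* Equiv.Perm (Fin (Nat.card (window (-m) m))) :=
  (Finite.equivFin (window (-m) m)).permCongrHom.toMonoidHom.comp (MulAction.toPermHom _ _)

theorem dHam_regularRep {m : ℕ} {a : window (-m) m} (ha : a ≠ 1) :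
    dHam (regularRep m a) 1 = 1 := by
  have h : ∀ i, regularRep m a i ≠ (1 : Equiv.Perm (Fin (Nat.card (window (-m) m)))) i := by
    intro i hi
    refine ha (mul_right_cancel (b := (Finite.equivFin (window (-m) m)).symm i) ?_)
    apply (Finite.equivFin (window (-m) m)).injective
    simpa [regularRep] using hi
  have hpos : (Nat.card (window (-m) m) : ℝ) ≠ 0 := Nat.cast_ne_zero.2 Nat.card_pos.ne'
  rw [dHam, Finset.filter_true_of_mem fun i _ => h i, Finset.card_univ, Fintype.card_fin,
    div_self hpos]

theorem not_isWeaklyStable : ¬ IsWeaklyStable alternatingEnrichment := by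
  intro H
  have hpart : IsPartialHom (fun m : ℕ => Nat.card (window (-m) m))
      fun m g => regularRep m (toWindow m g) := fun g h => by
    filter_upwards [eventually_toWindow_mul g h] with m hm
    rw [hm, map_mul]
  have hsep : IsSeparating (fun m : ℕ => Nat.card (window (-m) m))
      fun m g => regularRep m (toWindow m g) := fun g hg => tendsto_const_nhds.congr' <| by
    filter_upwards [eventually_toWindow_ne_one hg] with m hm
    rw [dHam_regularRep hm]
  obtain ⟨ψ, hψ, hclose⟩ := H _ (fun m => Nat.card_pos) _ hpart.isAlmostHom hsep
  have hc : cycle ≠ 1 := fun h => by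
    have := cycle_smul 0
    rw [h, one_smul] at this
    simp at this
  have h := hclose cycle
  have hψc : ∀ m, ψ m cycle = 1 := fun m => map_cycle_eq_one (MonoidHom.mk' (ψ m) (hψ m))
  simp only [hψc] at h
  exact zero_ne_one (tendsto_nhds_unique h (hsep cycle hc))

end alternatingEnrichment

/-- The alternating enrichment `𝒜(ℤ)` is locally stable but not weakly stable. -/
theorem alternatingEnrichment_locallyStable_not_weaklyStable :
    IsLocallyStable ↥alternatingEnrichment ∧ ¬ IsWeaklyStable ↥alternatingEnrichment :=
  ⟨alternatingEnrichment.isLocallyStable, alternatingEnrichment.not_isWeaklyStable⟩
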